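/- The category of unital real C*-algebras (morphisms: continuous unital *-homomorphisms) is equivalent to the category of pairs (A, τ), where A is a unital complex C*-algebra and τ : A → A is a conjugate-linear involution satisfying τ(ab) = τ(a)τ(b), τ(a)* = τ(a*) and τ(λ·1) = λ̄·1 for λ ∈ ℂ; morphisms of pairs are τ-equivariant unital *-homomorphisms. One direction of the equivalence sends a real C*-algebra B to (B ⊗_ℝ ℂ, complex conjugation); the quasi-inverse sends (A, τ) to the fixed-point subalgebra A^τ = {a ∈ A : τ(a) = a}. In particular, for every such pair (A, τ), the fixed subalgebra A^τ is a unital real C*-algebra, and A decomposes as A = A^τ ⊕ i·A^τ, so the canonical map A^τ ⊗_ℝ ℂ → A is bijective. -/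

import Mathlib

open CategoryTheory

/-- The category of unital real C*-algebras: real Banach algebras with a linear
involution `*` satisfying `(ab)* = b*a*` and the C*-identity `‖a*a‖ = ‖a‖²`, in which
moreover `1 + a*a` is invertible for every `a`.  Morphisms are continuous unital
*-homomorphisms. -/
structure RealCStarAlg : Type 1 where
  carrier : Type
  [isNormedRing : NormedRing carrier]
  [isStarRing : StarRing carrier]
  [isCStarRing : CStarRing carrier]
  [isNormedAlgebra : NormedAlgebra ℝ carrier]
  [isStarModule : StarModule ℝ carrier]
  [isCompleteSpace : CompleteSpace carrier]
  isUnit_one_add_star_mul_self : ∀ a : carrier, IsUnit (1 + star a * a)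

attribute [instance] RealCStarAlg.isNormedRing RealCStarAlg.isStarRing
  RealCStarAlg.isCStarRing RealCStarAlg.isNormedAlgebra RealCStarAlg.isStarModule
  RealCStarAlg.isCompleteSpace

instance : CoeSort RealCStarAlg Type := ⟨RealCStarAlg.carrier⟩

instance : Category RealCStarAlg where
  Hom A B := {f : A →⋆ₐ[ℝ] B // Continuous f}
  id A := ⟨StarAlgHom.id ℝ A, continuous_id⟩
  comp f g := ⟨g.1.comp f.1, g.2.comp f.2⟩
  id_comp _ := Subtype.ext (StarAlgHom.ext fun _ => rfl)
  comp_id _ := Subtype.ext (StarAlgHom.ext fun _ => rfl)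
  assoc _ _ _ := Subtype.ext (StarAlgHom.ext fun _ => rfl)

/-- A pair `(A, τ)`: a unital complex C*-algebra `A` together with a conjugate-linear
involution `τ` which is multiplicative, commutes with the C*-involution, and acts on
scalars by complex conjugation. -/
structure CStarConjPair : Type 1 where
  carrier : Type
  [isNormedRing : NormedRing carrier]
  [isStarRing : StarRing carrier]
  [isCStarRing : CStarRing carrier]
  [isNormedAlgebra : NormedAlgebra ℂ carrier]
  [isStarModule : StarModule ℂ carrier]
  [isCompleteSpace : CompleteSpace carrier]
  conj : carrier → carrier
  conj_conj : ∀ a, conj (conj a) = a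
  conj_add : ∀ a b, conj (a + b) = conj a + conj b
  conj_smul : ∀ (l : ℂ) (a : carrier), conj (l • a) = (starRingEnd ℂ l) • conj a
  conj_mul : ∀ a b, conj (a * b) = conj a * conj b
  conj_star : ∀ a, conj (star a) = star (conj a)
  conj_algebraMap : ∀ l : ℂ,
    conj (algebraMap ℂ carrier l) = algebraMap ℂ carrier (starRingEnd ℂ l)

attribute [instance] CStarConjPair.isNormedRing CStarConjPair.isStarRing
  CStarConjPair.isCStarRing CStarConjPair.isNormedAlgebra CStarConjPair.isStarModule
  CStarConjPair.isCompleteSpace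

instance : CoeSort CStarConjPair Type := ⟨CStarConjPair.carrier⟩

/-- Morphisms of pairs are `τ`-equivariant continuous unital *-homomorphisms. -/
instance : Category CStarConjPair where
  Hom A B := {f : A →⋆ₐ[ℂ] B // Continuous f ∧ ∀ a, f (A.conj a) = B.conj (f a)}
  id A := ⟨StarAlgHom.id ℂ A, continuous_id, fun _ => rfl⟩
  comp {A B C} f g := ⟨g.1.comp f.1, g.2.1.comp f.2.1, fun a =>
    (congrArg g.1 (f.2.2 a)).trans (g.2.2 (f.1 a))⟩
  id_comp _ := Subtype.ext (StarAlgHom.ext fun _ => rfl)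
  comp_id _ := Subtype.ext (StarAlgHom.ext fun _ => rfl)
  assoc _ _ _ := Subtype.ext (StarAlgHom.ext fun _ => rfl)


namespace RC

theorem isUnit_sub (B : RealCStarAlg) (c : ℝ) (k : B) (h : ‖k‖ < c) :
    IsUnit (algebraMap ℝ B c - k) := by
  have hc : 0 < c := lt_of_le_of_lt (norm_nonneg _) h
  have h1 : ‖c⁻¹ • k‖ < 1 := by
    rw [norm_smul, Real.norm_of_nonneg (by positivity), inv_mul_lt_iff₀ hc]; simpa using h
  have h2 := isUnit_one_sub_of_norm_lt_one h1
  have h3 : algebraMap ℝ B c - k = (algebraMap ℝ B c) * (1 - c⁻¹ • k) := by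
    rw [mul_sub, mul_one, ← Algebra.smul_def, smul_smul, mul_inv_cancel₀ hc.ne', one_smul]
  rw [h3]
  exact ((isUnit_iff_ne_zero.2 hc.ne').map (algebraMap ℝ B)).mul h2

/-- The dual action -/
noncomputable def L (B : RealCStarAlg) : B →ₐ[ℝ] ((B →L[ℝ] ℂ) →L[ℂ] (B →L[ℝ] ℂ)) :=
  AlgHom.ofLinearMap
    { toFun := fun b => LinearMap.mkContinuous
        { toFun := fun φ => φ.comp ((ContinuousLinearMap.mul ℝ B).flip b)
          map_add' := fun φ ψ => by ext; simp
          map_smul' := fun φ ψ => by ext; simp } ‖b‖ (fun φ => by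
            refine ContinuousLinearMap.opNorm_le_bound _ (by positivity) fun x => ?_
            simp only [LinearMap.coe_mk, AddHom.coe_mk, ContinuousLinearMap.comp_apply,
              ContinuousLinearMap.flip_apply, ContinuousLinearMap.mul_apply']
            calc ‖φ (x * b)‖ ≤ ‖φ‖ * ‖x * b‖ := φ.le_opNorm _
              _ ≤ ‖φ‖ * (‖x‖ * ‖b‖) := by gcongr; exact norm_mul_le _ _
              _ = _ := by ring)
      map_add' := fun a b => by ext φ x; simp [mul_add]
      map_smul' := fun a b => by ext φ x; simp }
    (by ext φ x; simp) (fun a b => by ext φ x; simp [mul_assoc])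

theorem L_apply (B : RealCStarAlg) (b : B) (φ : B →L[ℝ] ℂ) (x : B) : L B b φ x = φ (x * b) := rfl

theorem norm_one_le (B : RealCStarAlg) : ‖(1 : B)‖ ≤ 1 := by
  have h : ‖(1:B)‖ * ‖(1:B)‖ = ‖(1:B)‖ := by
    have := CStarRing.norm_star_mul_self (x := (1:B)); simpa using this.symm
  nlinarith [norm_nonneg (1:B)]

theorem norm_L (B : RealCStarAlg) (b : B) : ‖L B b‖ = ‖b‖ := by
  apply le_antisymm
  · refine ContinuousLinearMap.opNorm_le_bound _ (norm_nonneg _) fun φ => ?_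
    refine ContinuousLinearMap.opNorm_le_bound _ (by positivity) fun x => ?_
    rw [L_apply]
    calc ‖φ (x * b)‖ ≤ ‖φ‖ * ‖x * b‖ := φ.le_opNorm _
      _ ≤ ‖φ‖ * (‖x‖ * ‖b‖) := by gcongr; exact norm_mul_le _ _
      _ = _ := by ring
  · obtain ⟨g, hg, hgb⟩ := exists_dual_vector'' ℝ b
    let φ : B →L[ℝ] ℂ := Complex.ofRealCLM.comp g
    have hφ : ‖φ‖ ≤ 1 := by
      refine ContinuousLinearMap.opNorm_le_bound _ zero_le_one fun x => ?_
      have := g.le_opNorm x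
      simp only [φ, ContinuousLinearMap.comp_apply, Complex.ofRealCLM_apply, Complex.norm_real]
      refine this.trans ?_
      gcongr
    have h1 : ‖L B b φ 1‖ = ‖b‖ := by
      rw [L_apply]; simp [φ, hgb]
    rw [← h1]
    calc _ ≤ ‖L B b φ‖ * ‖(1:B)‖ := ContinuousLinearMap.le_opNorm _ _
      _ ≤ (‖L B b‖ * ‖φ‖) * ‖(1:B)‖ := by gcongr; exact ContinuousLinearMap.le_opNorm _ _
      _ ≤ (‖L B b‖ * 1) * 1 := by gcongr; exact norm_one_le B
      _ = _ := by ring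

theorem isUnit_pos_add (B : RealCStarAlg) (c : ℝ) (hc : 0 < c) (a : B) :
    IsUnit (algebraMap ℝ B c + star a * a) := by
  have h := B.isUnit_one_add_star_mul_self ((Real.sqrt c)⁻¹ • a)
  have h3 : algebraMap ℝ B c + star a * a =
      algebraMap ℝ B c * (1 + star ((Real.sqrt c)⁻¹ • a) * ((Real.sqrt c)⁻¹ • a)) := by
    rw [mul_add, mul_one, ← Algebra.smul_def, star_smul, smul_mul_smul_comm, smul_smul]
    have : c * (star (Real.sqrt c)⁻¹ * (Real.sqrt c)⁻¹) = 1 := by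
      rw [star_trivial, ← mul_inv, Real.mul_self_sqrt hc.le, mul_inv_cancel₀ hc.ne']
    rw [this, one_smul]
  rw [h3]
  exact ((isUnit_iff_ne_zero.2 hc.ne').map (algebraMap ℝ B)).mul h

theorem L_cast' (B : RealCStarAlg) (r : ℝ) : L B (algebraMap ℝ B r) = (r : ℂ) • 1 := by
  ext φ x
  rw [L_apply]
  simp [Algebra.algebraMap_eq_smul_one]

theorem isUnit_of_quadratic {A : Type*} [Ring A] [Algebra ℂ A] (T : A) (α β : ℝ)
    (hu : IsUnit (((β ^ 2 : ℝ) : ℂ) • (1 : A) + (T - (α : ℂ) • (1 : A)) * (T - (α : ℂ) • (1 : A)))) :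
    IsUnit (algebraMap ℂ A ⟨α, β⟩ - T) := by
  set z : ℂ := ⟨α, β⟩ with hz
  have hfac : ((β ^ 2 : ℝ) : ℂ) • (1 : A) + (T - (α : ℂ) • (1 : A)) * (T - (α : ℂ) • (1 : A))
      = (algebraMap ℂ A z - T) * (algebraMap ℂ A (star z) - T) := by
    have e1 : (star z : ℂ) = 2 * (α : ℂ) - z := by
      apply Complex.ext <;> simp [hz]; ring
    have e2 : ((β ^ 2 : ℝ) : ℂ) = z * star z - (α : ℂ) * α := by
      apply Complex.ext <;> simp [hz, pow_two] <;> ring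
    rw [e2, e1]
    simp only [Algebra.algebraMap_eq_smul_one, sub_mul, mul_sub, smul_mul_assoc, mul_smul_comm,
      one_mul, mul_one]
    generalize (1 : A) = e
    generalize T * T = t
    module
  rw [hfac] at hu
  have hcm : Commute (algebraMap ℂ A z - T) (algebraMap ℂ A (star z) - T) := by
    apply Commute.sub_left
    · exact Algebra.commutes _ _
    · exact (Commute.sub_right (Algebra.commutes _ _).symm (Commute.refl _))
  exact (hcm.isUnit_mul_iff.1 hu).1

theorem norm_le_of_isUnit_aux (B : RealCStarAlg) {A : Type*} [NormedRing A] [NormedAlgebra ℂ A]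
    [CompleteSpace A] (ℓ : B →+* A) (hℓ : ∀ b, ‖ℓ b‖ = ‖b‖)
    (hc : ∀ r : ℝ, ℓ (algebraMap ℝ B r) = (r : ℂ) • (1 : A)) (g : B) (hg : IsSelfAdjoint g) (R : ℝ) (hR0 : 0 ≤ R)
    (hR : ∀ t : ℝ, R < |t| → IsUnit (algebraMap ℝ B t - g)) : ‖g‖ ≤ R := by
  have hspec : ∀ z ∈ spectrum ℂ (ℓ g), ‖z‖ ≤ R := by
    intro z hz
    by_contra! hlt
    apply hz
    rw [spectrum.mem_resolventSet_iff]
    obtain ⟨α, β⟩ := z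
    by_cases hβ : β = 0
    · subst hβ
      have h1 : R < |α| := by
        have : (⟨α, 0⟩ : ℂ) = (α : ℂ) := rfl
        rw [this, Complex.norm_real] at hlt; exact hlt
      have h2 := (hR α h1).map ℓ
      rw [map_sub, hc] at h2
      rw [Algebra.algebraMap_eq_smul_one]
      exact h2
    · have hu := (isUnit_pos_add B (β ^ 2) (by positivity) (g - algebraMap ℝ B α)).map ℓ
      have hs : star (g - algebraMap ℝ B α) = g - algebraMap ℝ B α := by
        rw [star_sub, hg.star_eq, ← algebraMap_star_comm, star_trivial]
      rw [hs] at hu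
      rw [map_add, map_mul, map_sub, hc, hc] at hu
      exact isUnit_of_quadratic (ℓ g) α β hu
  have hrad : spectralRadius ℂ (ℓ g) ≤ ENNReal.ofReal R := by
    refine iSup₂_le fun z hz => ?_
    rw [← ENNReal.ofReal_coe_nnreal]
    exact ENNReal.ofReal_le_ofReal (hspec z hz)
  have ht := spectrum.pow_nnnorm_pow_one_div_tendsto_nhds_spectralRadius (ℓ g)
  have ht2 := ht.comp (tendsto_pow_atTop_atTop_of_one_lt (one_lt_two : (1:ℕ) < 2))
  have hconst : ∀ n : ℕ, ((‖ℓ g ^ (2 ^ n)‖₊ : ENNReal) ^ (1 / ((2 ^ n : ℕ) : ℝ))) = ‖g‖₊ := by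
    intro n
    have e : ‖ℓ g ^ (2 ^ n)‖₊ = ‖g‖₊ ^ (2 ^ n) := by
      rw [← map_pow, ← hg.nnnorm_pow_two_pow n]
      exact NNReal.eq (hℓ _)
    rw [e, ENNReal.coe_pow, ← ENNReal.rpow_natCast, ← ENNReal.rpow_mul, mul_one_div_cancel (by positivity), ENNReal.rpow_one]
  have heq : spectralRadius ℂ (ℓ g) = ‖g‖₊ := by
    refine tendsto_nhds_unique ht2 ?_
    refine Filter.Tendsto.congr (fun n => (hconst n).symm) tendsto_const_nhds
  rw [heq, ← ENNReal.ofReal_coe_nnreal, ENNReal.ofReal_le_ofReal_iff hR0] at hrad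
  exact hrad

theorem norm_le_of_isUnit (B : RealCStarAlg) (g : B) (hg : IsSelfAdjoint g) (R : ℝ) (hR0 : 0 ≤ R)
    (hR : ∀ t : ℝ, R < |t| → IsUnit (algebraMap ℝ B t - g)) : ‖g‖ ≤ R :=
  norm_le_of_isUnit_aux B (A := (B →L[ℝ] ℂ) →L[ℂ] (B →L[ℝ] ℂ)) (L B).toRingHom (norm_L B)
    (fun r => L_cast' B r) g hg R hR0 hR

/-- Positivity. -/
def Pos (B : RealCStarAlg) (h : B) : Prop :=
  IsSelfAdjoint h ∧ ∃ t : ℝ, ‖algebraMap ℝ B t - h‖ ≤ t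

variable {B : RealCStarAlg}

theorem Pos.add {a b : B} (ha : Pos B a) (hb : Pos B b) : Pos B (a + b) := by
  obtain ⟨ha, t, ht⟩ := ha
  obtain ⟨hb, s, hs⟩ := hb
  refine ⟨ha.add hb, t + s, ?_⟩
  have : algebraMap ℝ B (t + s) - (a + b) = (algebraMap ℝ B t - a) + (algebraMap ℝ B s - b) := by
    rw [map_add]; abel
  rw [this]
  exact (norm_add_le _ _).trans (add_le_add ht hs)

theorem Pos.smul {a : B} (ha : Pos B a) {c : ℝ} (hc : 0 ≤ c) : Pos B (c • a) := by
  obtain ⟨ha, t, ht⟩ := ha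
  refine ⟨(IsSelfAdjoint.all c).smul ha, c * t, ?_⟩
  have : algebraMap ℝ B (c * t) - c • a = c • (algebraMap ℝ B t - a) := by
    rw [smul_sub, map_mul, ← Algebra.smul_def]
  rw [this, norm_smul, Real.norm_of_nonneg hc]
  gcongr

theorem isSelfAdjoint_algebraMap (t : ℝ) : IsSelfAdjoint (algebraMap ℝ B t) := by
  rw [IsSelfAdjoint, ← algebraMap_star_comm, star_trivial]

theorem Pos.isUnit {a : B} (ha : Pos B a) {c : ℝ} (hc : 0 < c) : IsUnit (algebraMap ℝ B c + a) := by
  obtain ⟨ha, t, ht⟩ := ha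
  have := isUnit_sub B (c + t) (algebraMap ℝ B t - a) (by linarith)
  convert this using 1
  rw [map_add]; abel

/-- spectral characterisation gives positivity with explicit constant -/
theorem Pos.norm_le {p : B} (hp : Pos B p) {s : ℝ} (hs0 : 0 ≤ s)
    (hs : Pos B (algebraMap ℝ B s - p)) : ‖p‖ ≤ s := by
  refine norm_le_of_isUnit B p hp.1 s hs0 fun u hu => ?_
  rcases lt_abs.1 hu with h | h
  · have := hs.isUnit (c := u - s) (by linarith)
    convert this using 1
    rw [map_sub]; abel
  · have := (hp.isUnit (c := -u) (by linarith)).neg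
    convert this using 1
    rw [map_neg]; abel

theorem pos_norm_sub {h : B} (hh : IsSelfAdjoint h) {t : ℝ} (ht : ‖h‖ ≤ t) :
    Pos B (algebraMap ℝ B t - h) :=
  ⟨(isSelfAdjoint_algebraMap t).sub hh, t, by simpa using ht⟩

/-- monotonicity of the norm -/
theorem Pos.norm_mono {p q : B} (hp : Pos B p) (hq : Pos B (q - p)) : ‖p‖ ≤ ‖q‖ := by
  have hqs : IsSelfAdjoint q := by simpa using hq.1.add hp.1
  refine hp.norm_le (norm_nonneg _) ?_
  have := (pos_norm_sub hqs le_rfl).add hq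
  simpa using this

/-- The constant may be taken to be anything at least the norm. -/
theorem norm_sub_le_of_isUnit {h : B} (hh : IsSelfAdjoint h)
    (hu : ∀ c : ℝ, 0 < c → IsUnit (algebraMap ℝ B c + h)) {t : ℝ} (ht : ‖h‖ ≤ t) :
    ‖algebraMap ℝ B t - h‖ ≤ t := by
  have ht0 : 0 ≤ t := (norm_nonneg _).trans ht
  refine norm_le_of_isUnit B _ ((isSelfAdjoint_algebraMap t).sub hh) t ht0 fun u hu' => ?_
  rcases lt_abs.1 hu' with h' | h'
  · have := hu (u - t) (by linarith)
    convert this using 1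
    rw [map_sub]; abel
  · have := (isUnit_sub B (t - u) h (by linarith)).neg
    convert this using 1
    rw [map_sub]; abel

theorem pos_star_mul_self (a : B) : Pos B (star a * a) :=
  ⟨IsSelfAdjoint.star_mul_self a, ‖star a * a‖, norm_sub_le_of_isUnit
    (IsSelfAdjoint.star_mul_self a) (fun c hc => isUnit_pos_add B c hc a) le_rfl⟩

theorem pos_of_forall {h : B} (hh : IsSelfAdjoint h)
    (H : ∀ ε : ℝ, 0 < ε → Pos B (algebraMap ℝ B ε + h)) : Pos B h := by
  refine ⟨hh, ‖h‖, norm_sub_le_of_isUnit hh (fun c hc => ?_) le_rfl⟩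
  have := (H (c / 2) (by positivity)).isUnit (c := c / 2) (by positivity)
  convert this using 1
  rw [← add_assoc, ← map_add, add_halves]

/-- square roots -/
theorem exists_sqrt (k : B) (hk : IsSelfAdjoint k) (r : ℝ) (hr : r < 1) (hkr : ‖k‖ ≤ r) :
    ∃ s : B, IsSelfAdjoint s ∧ s * s = 1 - k := by
  have hr0 : 0 ≤ r := (norm_nonneg _).trans hkr
  let S : Set B := {y | IsSelfAdjoint y ∧ ‖y‖ ≤ r}
  have hS : IsClosed S := (isClosed_eq continuous_star continuous_id).inter
    (isClosed_le continuous_norm continuous_const)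
  let f : B → B := fun y => (1/2 : ℝ) • (k + y * y)
  have hf : Set.MapsTo f S S := by
    rintro y ⟨hy, hyr⟩
    refine ⟨(IsSelfAdjoint.all _).smul (hk.add ?_), ?_⟩
    · rw [IsSelfAdjoint, star_mul, hy.star_eq]
    · have h1 : ‖k + y * y‖ ≤ r + r * r := (norm_add_le _ _).trans
        (add_le_add hkr ((norm_mul_le _ _).trans (by gcongr)))
      simp only [f, norm_smul]
      rw [Real.norm_of_nonneg (by norm_num)]
      nlinarith
  have hcon : ContractingWith ⟨r, hr0⟩ (hf.restrict f S S) := by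
    refine ⟨by exact_mod_cast hr, LipschitzWith.of_dist_le_mul ?_⟩
    rintro ⟨y, hy, hyr⟩ ⟨z, hz, hzr⟩
    simp only [Subtype.dist_eq, Set.MapsTo.val_restrict_apply, f]
    rw [dist_eq_norm, dist_eq_norm, ← smul_sub, norm_smul, Real.norm_of_nonneg (by norm_num)]
    have : k + y * y - (k + z * z) = y * (y - z) + (y - z) * z := by noncomm_ring
    rw [this]
    have h1 : ‖y * (y - z) + (y - z) * z‖ ≤ r * ‖y - z‖ + ‖y - z‖ * r :=
      (norm_add_le _ _).trans (add_le_add ((norm_mul_le _ _).trans (by gcongr))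
        ((norm_mul_le _ _).trans (by gcongr)))
    show _ ≤ r * ‖y - z‖
    linarith
  obtain ⟨y, hyS, hy, -⟩ := hcon.exists_fixedPoint' hS.isComplete hf (x := (0 : B))
    ⟨IsSelfAdjoint.zero _, by simpa using hr0⟩ (edist_ne_top _ _)
  refine ⟨1 - y, (IsSelfAdjoint.one _).sub hyS.1, ?_⟩
  have h2 : (2:ℝ) • y = k + y * y := by
    have : f y = y := hy
    conv_lhs => rw [← this]
    simp [f, smul_smul]
  rw [two_smul] at h2
  have : (1 - y) * (1 - y) = 1 - (y + y) + y * y := by noncomm_ring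
  rw [this, h2]; abel

theorem Pos.conj_unit {h : B} (hh : Pos B h) {ε : ℝ} (hε : 0 < ε) :
    ∃ s : B, IsSelfAdjoint s ∧ s * s = algebraMap ℝ B ε + h := by
  obtain ⟨hs, t, ht⟩ := hh
  have ht0 : 0 ≤ t := (norm_nonneg _).trans ht
  have hc : 0 < ε + t := by linarith
  obtain ⟨s, hs1, hs2⟩ := exists_sqrt ((ε + t)⁻¹ • (algebraMap ℝ B t - h))
    ((IsSelfAdjoint.all _).smul ((isSelfAdjoint_algebraMap t).sub hs)) (t / (ε + t))
    (by rw [div_lt_one hc]; linarith)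
    (by rw [norm_smul, Real.norm_of_nonneg (by positivity), div_eq_inv_mul]; gcongr)
  refine ⟨Real.sqrt (ε + t) • s, (IsSelfAdjoint.all _).smul hs1, ?_⟩
  rw [smul_mul_smul_comm, Real.mul_self_sqrt hc.le, hs2, smul_sub, smul_smul,
    mul_inv_cancel₀ hc.ne', one_smul, ← Algebra.algebraMap_eq_smul_one, map_add]
  abel

theorem Pos.conj {h : B} (hh : Pos B h) (b : B) : Pos B (star b * h * b) := by
  have hsa : IsSelfAdjoint (star b * h * b) := by
    rw [IsSelfAdjoint, star_mul, star_mul, star_star, hh.1.star_eq, mul_assoc]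
  refine pos_of_forall hsa fun ε hε => ?_
  obtain ⟨s, hs1, hs2⟩ := hh.conj_unit (ε := ε / (‖b‖ ^ 2 + 1)) (by positivity)
  set δ := ε / (‖b‖ ^ 2 + 1) with hδ
  have hδ0 : 0 < δ := by positivity
  have h1 := pos_star_mul_self (s * b)
  have h2 : star (s * b) * (s * b) = δ • (star b * b) + star b * h * b := by
    rw [star_mul, hs1.star_eq]
    calc _ = star b * (s * s) * b := by noncomm_ring
      _ = _ := by rw [hs2, Algebra.algebraMap_eq_smul_one, mul_add, add_mul]; simp
  rw [h2] at h1
  have h3 : Pos B (algebraMap ℝ B ε - δ • (star b * b)) := by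
    refine pos_norm_sub ((IsSelfAdjoint.all _).smul (IsSelfAdjoint.star_mul_self b)) ?_
    rw [norm_smul, Real.norm_of_nonneg hδ0.le, CStarRing.norm_star_mul_self, hδ,
      div_mul_eq_mul_div, div_le_iff₀ (by positivity)]
    nlinarith
  have := h3.add h1
  convert this using 1
  abel

end RC

namespace RC

/-- Complexification. -/
@[ext]
structure Cx (B : RealCStarAlg) : Type where
  re : B.carrier
  im : B.carrier

namespace Cx

variable {B : RealCStarAlg}

instance : Zero (Cx B) := ⟨⟨0, 0⟩⟩
instance : One (Cx B) := ⟨⟨1, 0⟩⟩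
instance : Add (Cx B) := ⟨fun z w => ⟨z.re + w.re, z.im + w.im⟩⟩
instance : Neg (Cx B) := ⟨fun z => ⟨-z.re, -z.im⟩⟩
instance : Mul (Cx B) := ⟨fun z w => ⟨z.re * w.re - z.im * w.im, z.re * w.im + z.im * w.re⟩⟩
instance : SMul ℂ (Cx B) := ⟨fun c w => ⟨c.re • w.re - c.im • w.im, c.re • w.im + c.im • w.re⟩⟩
instance : Star (Cx B) := ⟨fun z => ⟨star z.re, -star z.im⟩⟩

@[simp] theorem zero_re : (0 : Cx B).re = 0 := rfl
@[simp] theorem zero_im : (0 : Cx B).im = 0 := rfl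
@[simp] theorem one_re : (1 : Cx B).re = 1 := rfl
@[simp] theorem one_im : (1 : Cx B).im = 0 := rfl
@[simp] theorem add_re (z w : Cx B) : (z + w).re = z.re + w.re := rfl
@[simp] theorem add_im (z w : Cx B) : (z + w).im = z.im + w.im := rfl
@[simp] theorem neg_re (z : Cx B) : (-z).re = -z.re := rfl
@[simp] theorem neg_im (z : Cx B) : (-z).im = -z.im := rfl
@[simp] theorem mul_re (z w : Cx B) : (z * w).re = z.re * w.re - z.im * w.im := rfl
@[simp] theorem mul_im (z w : Cx B) : (z * w).im = z.re * w.im + z.im * w.re := rfl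
@[simp] theorem smul_re (c : ℂ) (w : Cx B) : (c • w).re = c.re • w.re - c.im • w.im := rfl
@[simp] theorem smul_im (c : ℂ) (w : Cx B) : (c • w).im = c.re • w.im + c.im • w.re := rfl
@[simp] theorem star_re (z : Cx B) : (star z).re = star z.re := rfl
@[simp] theorem star_im (z : Cx B) : (star z).im = -star z.im := rfl

instance : Ring (Cx B) where
  add_assoc a b c := by ext <;> simp [add_assoc]
  zero_add a := by ext <;> simp
  add_zero a := by ext <;> simp
  nsmul := nsmulRec
  add_comm a b := by ext <;> simp [add_comm]
  left_distrib a b c := by ext <;> simp <;> noncomm_ring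
  right_distrib a b c := by ext <;> simp <;> noncomm_ring
  zero_mul a := by ext <;> simp
  mul_zero a := by ext <;> simp
  mul_assoc a b c := by ext <;> simp <;> noncomm_ring
  one_mul a := by ext <;> simp
  mul_one a := by ext <;> simp
  zsmul := zsmulRec
  neg_add_cancel a := by ext <;> simp

@[simp] theorem sub_re (z w : Cx B) : (z - w).re = z.re - w.re := by
  rw [sub_eq_add_neg, sub_eq_add_neg]; rfl
@[simp] theorem sub_im (z w : Cx B) : (z - w).im = z.im - w.im := by
  rw [sub_eq_add_neg, sub_eq_add_neg]; rfl

instance : Module ℂ (Cx B) where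
  one_smul a := by ext <;> simp
  mul_smul a b c := by ext <;> simp <;> module
  smul_zero a := by ext <;> simp
  smul_add a b c := by ext <;> simp <;> module
  add_smul a b c := by ext <;> simp <;> module
  zero_smul a := by ext <;> simp

instance : Algebra ℂ (Cx B) := Algebra.ofModule
  (fun c x y => by
    ext <;> simp only [smul_re, smul_im, mul_re, mul_im, sub_mul, add_mul, smul_mul_assoc] <;> module)
  (fun c x y => by
    ext <;> simp only [smul_re, smul_im, mul_re, mul_im, mul_sub, mul_add, mul_smul_comm] <;> module)

instance : StarRing (Cx B) where
  star_involutive a := by ext <;> simp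
  star_mul a b := by
    ext <;> simp
  star_add a b := by ext <;> simp; abel

instance : StarModule ℂ (Cx B) where
  star_smul c a := by
    ext <;> simp [sub_eq_add_neg, add_comm]

/-- inner product -/
def inn (u v : Cx B) : B := star u.re * v.re + star u.im * v.im

theorem inn_mul (z u v : Cx B) : inn (z * u) v = inn u (star z * v) := by
  simp [inn, mul_sub, mul_add, sub_mul, add_mul, mul_assoc]; abel

theorem pos_inn (u : Cx B) : Pos B (inn u u) := (pos_star_mul_self _).add (pos_star_mul_self _)

theorem star_inn (u v : Cx B) : star (inn u v) = inn v u := by simp [inn]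

theorem pos_conj_le (x b : B) (U : ℝ) (h : Pos B (algebraMap ℝ B U - x)) :
    Pos B (U • (star b * b) - star b * x * b) := by
  have := h.conj b
  convert this using 1
  rw [mul_sub, sub_mul, Algebra.algebraMap_eq_smul_one]; simp

/-- Cauchy Schwarz -/
theorem norm_inn_le (u v : Cx B) : ‖inn u v‖ ^ 2 ≤ ‖inn u u‖ * ‖inn v v‖ := by
  have key : ∀ U : ℝ, 0 < U → ‖inn u u‖ ≤ U → ‖inn u v‖ ^ 2 ≤ U * ‖inn v v‖ := by
    intro U hU hle
    set x := inn u v with hx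
    have h1 := pos_conj_le (inn u u) x U (pos_norm_sub (pos_inn u).1 hle)
    have h2 := pos_inn (v - ⟨U⁻¹ • (u.re * x), U⁻¹ • (u.im * x)⟩)
    have h3 : inn (v - ⟨U⁻¹ • (u.re * x), U⁻¹ • (u.im * x)⟩)
        (v - ⟨U⁻¹ • (u.re * x), U⁻¹ • (u.im * x)⟩) = inn v v - U⁻¹ • (star x * x)
          - U⁻¹ • (star x * x) + (U⁻¹ * U⁻¹) • (star x * inn u u * x) := by
      have e1 : star x * x = star x * (star u.re * v.re) + star x * (star u.im * v.im) := by
        rw [← mul_add]; rfl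
      have e2 : star x * x = star v.re * (u.re * x) + star v.im * (u.im * x) := by
        rw [hx, star_inn, inn, add_mul, mul_assoc, mul_assoc]
      conv_rhs => 
        enter [1, 2]
        rw [e1]
      rw [e2]
      simp only [inn, sub_re, sub_im, star_sub, star_smul, star_mul, star_trivial, sub_mul, mul_sub,
        smul_mul_assoc, mul_smul_comm, mul_add, add_mul, mul_assoc]
      module
    rw [h3] at h2
    have h4 : Pos B (inn v v - U⁻¹ • (star x * x)) := by
      have := h2.add (h1.smul (c := U⁻¹ * U⁻¹) (by positivity))
      convert this using 1
      rw [smul_sub, smul_smul, mul_assoc U⁻¹, inv_mul_cancel₀ hU.ne', mul_one]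
      abel
    have h5 := ((pos_star_mul_self x).smul (inv_nonneg.2 hU.le)).norm_mono h4
    rw [norm_smul, CStarRing.norm_star_mul_self, Real.norm_of_nonneg (by positivity),
      inv_mul_le_iff₀ hU] at h5
    nlinarith
  refine le_of_forall_pos_le_add fun ε hε => ?_
  have h := key (‖inn u u‖ + ε / (‖inn v v‖ + 1)) (by positivity) (by
    have : 0 ≤ ε / (‖inn v v‖ + 1) := by positivity
    linarith)
  refine h.trans ?_
  rw [add_mul]
  gcongr
  rw [div_mul_eq_mul_div, div_le_iff₀ (by positivity)]
  nlinarith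

theorem inn_add (u v w : Cx B) : inn u (v + w) = inn u v + inn u w := by
  simp [inn, mul_add]; abel

theorem add_inn (u v w : Cx B) : inn (u + v) w = inn u w + inn v w := by
  simp [inn, add_mul]; abel

theorem norm_re_le (u : Cx B) : ‖u.re‖ ^ 2 ≤ ‖inn u u‖ := by
  have := (pos_star_mul_self u.re).norm_mono (q := inn u u) (by
    have := pos_star_mul_self u.im
    convert this using 1
    simp [inn])
  rw [CStarRing.norm_star_mul_self] at this
  nlinarith

theorem norm_im_le (u : Cx B) : ‖u.im‖ ^ 2 ≤ ‖inn u u‖ := by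
  have := (pos_star_mul_self u.im).norm_mono (q := inn u u) (by
    have := pos_star_mul_self u.re
    convert this using 1
    simp [inn])
  rw [CStarRing.norm_star_mul_self] at this
  nlinarith

/-- smul by complex scalars -/
theorem inn_smul_smul (c : ℂ) (u : Cx B) : inn (c • u) (c • u) = (‖c‖ ^ 2) • inn u u := by
  rw [Complex.sq_norm, Complex.normSq_apply]
  simp only [inn, smul_re, smul_im, star_sub, star_add, star_smul, star_trivial, sub_mul, mul_sub,
    add_mul, mul_add, smul_mul_assoc, mul_smul_comm]
  module

theorem pos_left (x : B) (w : Cx B) :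
    Pos B (‖x‖ ^ 2 • inn w w - inn (⟨x, 0⟩ * w) (⟨x, 0⟩ * w)) := by
  have h0 : Pos B (algebraMap ℝ B (‖x‖ ^ 2) - star x * x) :=
    pos_norm_sub (IsSelfAdjoint.star_mul_self x) (by rw [CStarRing.norm_star_mul_self, pow_two])
  have := (pos_conj_le _ w.re _ h0).add (pos_conj_le _ w.im _ h0)
  convert this using 1
  simp [inn, mul_assoc]; abel

end Cx

/-- Type synonym carrying the Hilbert module norm. -/
def CE (B : RealCStarAlg) : Type := Cx B

namespace CE

variable {B : RealCStarAlg}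

instance : AddCommGroup (CE B) := inferInstanceAs (AddCommGroup (Cx B))
instance : Module ℂ (CE B) := inferInstanceAs (Module ℂ (Cx B))

/-- to CE -/
def mk (u : Cx B) : CE B := u
/-- from CE -/
def un (u : CE B) : Cx B := u

noncomputable instance : Norm (CE B) := ⟨fun u => Real.sqrt ‖Cx.inn u.un u.un‖⟩

theorem norm_def (u : CE B) : ‖u‖ = Real.sqrt ‖Cx.inn u.un u.un‖ := rfl

theorem norm_sq (u : CE B) : ‖u‖ ^ 2 = ‖Cx.inn u.un u.un‖ := Real.sq_sqrt (norm_nonneg _)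

theorem norm_nn (u : CE B) : 0 ≤ ‖u‖ := Real.sqrt_nonneg _

theorem norm_inn (u v : CE B) : ‖Cx.inn u.un v.un‖ ≤ ‖u‖ * ‖v‖ := by
  refine abs_le_of_sq_le_sq' ?_ (mul_nonneg (norm_nn _) (norm_nn _)) |>.2
  rw [mul_pow, norm_sq, norm_sq]
  exact Cx.norm_inn_le _ _

theorem core : NormedSpace.Core ℂ (CE B) where
  norm_nonneg := norm_nn
  norm_smul c u := by
    refine (sq_eq_sq₀ (norm_nn _) (mul_nonneg (norm_nonneg _) (norm_nn _))).1 ?_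
    rw [mul_pow, norm_sq, norm_sq]
    have : (c • u).un = c • u.un := rfl
    rw [this, Cx.inn_smul_smul, norm_smul, Real.norm_of_nonneg (by positivity)]
  norm_triangle u v := by
    refine (sq_le_sq₀ (norm_nn _) (add_nonneg (norm_nn _) (norm_nn _))).1 ?_
    rw [norm_sq]
    have : (u + v).un = u.un + v.un := rfl
    rw [this, Cx.add_inn, Cx.inn_add, Cx.inn_add]
    have h1 := norm_inn u u
    have h2 := norm_inn u v
    have h3 := norm_inn v u
    have h4 := norm_inn v v
    calc _ ≤ (‖Cx.inn u.un u.un‖ + ‖Cx.inn u.un v.un‖) + (‖Cx.inn v.un u.un‖ + ‖Cx.inn v.un v.un‖) :=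
          (norm_add_le _ _).trans (add_le_add (norm_add_le _ _) (norm_add_le _ _))
      _ ≤ _ := by nlinarith
  norm_eq_zero_iff u := by
    constructor
    · intro h
      have h0 : ‖Cx.inn u.un u.un‖ = 0 := by rw [← norm_sq, h]; simp
      have h1 := Cx.norm_re_le u.un
      have h2 := Cx.norm_im_le u.un
      rw [h0] at h1 h2
      have h1' : ‖u.un.re‖ = 0 := by nlinarith [norm_nonneg u.un.re]
      have h2' : ‖u.un.im‖ = 0 := by nlinarith [norm_nonneg u.un.im]
      exact Cx.ext (norm_eq_zero.1 h1') (norm_eq_zero.1 h2')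
    · rintro rfl
      have : Cx.inn (0 : CE B).un (0 : CE B).un = 0 := by
        show Cx.inn (0 : Cx B) 0 = 0
        simp [Cx.inn]
      rw [norm_def, this]; simp

noncomputable instance : NormedAddCommGroup (CE B) := NormedAddCommGroup.ofCore core
noncomputable instance : NormedSpace ℂ (CE B) := NormedSpace.ofCore core

theorem norm_re_le (u : CE B) : ‖u.un.re‖ ≤ ‖u‖ :=
  abs_le_of_sq_le_sq' (by rw [norm_sq]; exact Cx.norm_re_le _) (norm_nn _) |>.2
theorem norm_im_le (u : CE B) : ‖u.un.im‖ ≤ ‖u‖ :=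
  abs_le_of_sq_le_sq' (by rw [norm_sq]; exact Cx.norm_im_le _) (norm_nn _) |>.2

theorem norm_left (x : B) (w : CE B) : ‖mk (⟨x, 0⟩ * w.un)‖ ≤ ‖x‖ * ‖w‖ := by
  refine (sq_le_sq₀ (norm_nn _) (mul_nonneg (norm_nonneg _) (norm_nn _))).1 ?_
  rw [mul_pow, norm_sq, norm_sq]
  have := (Cx.pos_inn (⟨x, 0⟩ * w.un)).norm_mono (Cx.pos_left x w.un)
  rwa [norm_smul, Real.norm_of_nonneg (by positivity)] at this

theorem norm_mul (z : Cx B) (w : CE B) : ‖mk (z * w.un)‖ ≤ (‖z.re‖ + ‖z.im‖) * ‖w‖ := by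
  have h : mk (z * w.un) = mk (⟨z.re, 0⟩ * w.un) + Complex.I • mk (⟨z.im, 0⟩ * w.un) := by
    show z * w.un = (⟨z.re, 0⟩ * w.un : Cx B) + Complex.I • (⟨z.im, 0⟩ * w.un : Cx B)
    ext <;> simp; abel
  rw [h, add_mul]
  refine (norm_add_le _ _).trans (add_le_add (norm_left _ _) ?_)
  rw [norm_smul, Complex.norm_I, one_mul]
  exact norm_left _ _

end CE

variable {B : RealCStarAlg}

/-- left regular representation -/
noncomputable def rep (B : RealCStarAlg) : Cx B →ₐ[ℂ] (CE B →L[ℂ] CE B) :=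
  AlgHom.ofLinearMap
    { toFun := fun z => LinearMap.mkContinuous
        { toFun := fun w => CE.mk (z * w.un)
          map_add' := fun w v => mul_add z w.un v.un
          map_smul' := fun c w => mul_smul_comm c z w.un } (‖z.re‖ + ‖z.im‖) (CE.norm_mul z)
      map_add' := fun z z' => ContinuousLinearMap.ext fun w => add_mul z z' w.un
      map_smul' := fun c z => ContinuousLinearMap.ext fun w => smul_mul_assoc c z w.un }
    (ContinuousLinearMap.ext fun w => one_mul w.un)
    (fun z z' => ContinuousLinearMap.ext fun w => mul_assoc z z' w.un)

theorem rep_apply (z : Cx B) (w : CE B) : rep B z w = CE.mk (z * w.un) := rfl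

theorem norm_rep_le (z : Cx B) : ‖rep B z‖ ≤ ‖z.re‖ + ‖z.im‖ :=
  ContinuousLinearMap.opNorm_le_bound _ (by positivity) (CE.norm_mul z)

theorem le_norm_rep (z : Cx B) : ‖CE.mk z‖ ≤ ‖rep B z‖ := by
  have h := (rep B z).le_opNorm (CE.mk 1)
  have h1 : rep B z (CE.mk 1) = CE.mk z := mul_one z
  have h2 : ‖CE.mk (1 : Cx B)‖ ≤ 1 := by
    rw [CE.norm_def]
    refine Real.sqrt_le_iff.2 ⟨zero_le_one, ?_⟩
    show ‖Cx.inn (1 : Cx B) 1‖ ≤ 1 ^ 2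
    simpa [Cx.inn] using norm_one_le B
  rw [h1] at h
  exact h.trans (mul_le_of_le_one_right (norm_nonneg _) h2)

theorem rep_injective : Function.Injective (rep B) := by
  rw [injective_iff_map_eq_zero]
  intro z hz
  have h := le_norm_rep z
  rw [hz, norm_zero] at h
  exact norm_le_zero_iff.1 h

noncomputable instance : NormedRing (Cx B) := NormedRing.induced _ _ (rep B) rep_injective

theorem norm_eq_rep (z : Cx B) : ‖z‖ = ‖rep B z‖ := rfl

noncomputable instance : NormedAlgebra ℂ (Cx B) := NormedAlgebra.induced ℂ _ _ (rep B)

theorem norm_re_le (z : Cx B) : ‖z.re‖ ≤ ‖z‖ := (CE.norm_re_le (CE.mk z)).trans (le_norm_rep z)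
theorem norm_im_le (z : Cx B) : ‖z.im‖ ≤ ‖z‖ := (CE.norm_im_le (CE.mk z)).trans (le_norm_rep z)
theorem norm_le (z : Cx B) : ‖z‖ ≤ ‖z.re‖ + ‖z.im‖ := norm_rep_le z

instance : CStarRing (Cx B) where
  norm_mul_self_le z := by
    have h : ‖rep B z‖ ≤ Real.sqrt ‖star z * z‖ := by
      refine ContinuousLinearMap.opNorm_le_bound _ (Real.sqrt_nonneg _) fun w => ?_
      refine (sq_le_sq₀ (norm_nonneg _) (mul_nonneg (Real.sqrt_nonneg _) (norm_nonneg _))).1 ?_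
      rw [mul_pow, Real.sq_sqrt (norm_nonneg _), CE.norm_sq]
      have h1 : Cx.inn (rep B z w).un (rep B z w).un =
          Cx.inn w.un (rep B (star z * z) w).un := by
        show Cx.inn (z * w.un) (z * w.un) = Cx.inn w.un (star z * z * w.un)
        rw [Cx.inn_mul, mul_assoc]
      rw [h1]
      refine (CE.norm_inn _ _).trans ?_
      have := (rep B (star z * z)).le_opNorm w
      rw [norm_eq_rep]
      nlinarith [norm_nonneg w]
    rw [← norm_eq_rep] at h
    have := mul_self_le_mul_self (norm_nonneg _) h
    rwa [Real.mul_self_sqrt (norm_nonneg _)] at this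

theorem complete_of {E F : Type*} [NormedAddCommGroup E] [NormedAddCommGroup F] [CompleteSpace F]
    (f g : E →+ F) (hf : ∀ z, ‖f z‖ ≤ ‖z‖) (hg : ∀ z, ‖g z‖ ≤ ‖z‖) (h : ∀ z, ‖z‖ ≤ ‖f z‖ + ‖g z‖)
    (hs : ∀ x y, ∃ z, f z = x ∧ g z = y) : CompleteSpace E := by
  refine Metric.complete_of_cauchySeq_tendsto fun u hu => ?_
  have hmap : ∀ f : E →+ F, (∀ z, ‖f z‖ ≤ ‖z‖) → CauchySeq fun n => f (u n) := by
    intro f hf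
    rw [Metric.cauchySeq_iff] at hu ⊢
    intro ε hε
    obtain ⟨N, hN⟩ := hu ε hε
    refine ⟨N, fun m hm n hn => lt_of_le_of_lt ?_ (hN m hm n hn)⟩
    rw [dist_eq_norm, dist_eq_norm, ← map_sub]
    exact hf _
  obtain ⟨x, hx⟩ := cauchySeq_tendsto_of_complete (hmap f hf)
  obtain ⟨y, hy⟩ := cauchySeq_tendsto_of_complete (hmap g hg)
  obtain ⟨z, rfl, rfl⟩ := hs x y
  refine ⟨z, ?_⟩
  rw [tendsto_iff_norm_sub_tendsto_zero] at hx hy ⊢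
  have h' := hx.add hy
  rw [add_zero] at h'
  refine squeeze_zero (fun _ => norm_nonneg _) (fun n => ?_) h'
  simpa using h (u n - z)

instance : CompleteSpace (Cx B) :=
  complete_of (E := Cx B) (F := B) (AddMonoidHom.mk' Cx.re Cx.add_re) (AddMonoidHom.mk' Cx.im Cx.add_im)
    norm_re_le norm_im_le norm_le (fun x y => ⟨⟨x, y⟩, rfl, rfl⟩)

/-- the complexified pair -/
noncomputable def toPair (B : RealCStarAlg) : CStarConjPair where
  carrier := Cx B
  conj z := ⟨z.re, -z.im⟩
  conj_conj z := by ext <;> simp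
  conj_add z w := by ext <;> simp; abel
  conj_smul c z := by ext <;> simp; abel
  conj_mul z w := by ext <;> simp; abel
  conj_star z := by ext <;> simp
  conj_algebraMap c := by
    rw [Algebra.algebraMap_eq_smul_one, Algebra.algebraMap_eq_smul_one]
    ext <;> simp

end RC

namespace RC

section pair
variable (P : CStarConjPair)

noncomputable instance pairCStar : CStarAlgebra P.carrier where

theorem conj_one : P.conj 1 = 1 := by
  have := P.conj_algebraMap 1
  simpa using this

theorem conj_zero : P.conj 0 = 0 := by
  have := P.conj_algebraMap 0
  simpa using this

theorem conj_neg (a : P.carrier) : P.conj (-a) = - P.conj a := by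
  have := P.conj_smul (-1) a
  simpa using this

theorem conj_sub (a b : P.carrier) : P.conj (a - b) = P.conj a - P.conj b := by
  rw [sub_eq_add_neg, P.conj_add, conj_neg, sub_eq_add_neg]

theorem conj_isUnit {a : P.carrier} (h : IsUnit a) : IsUnit (P.conj a) := by
  obtain ⟨u, rfl⟩ := h
  refine ⟨⟨P.conj u, P.conj (↑u⁻¹), ?_, ?_⟩, rfl⟩
  · rw [← P.conj_mul, Units.mul_inv, conj_one]
  · rw [← P.conj_mul, Units.inv_mul, conj_one]

theorem conj_spectrum {a : P.carrier} {l : ℂ} (h : l ∈ spectrum ℂ (P.conj a)) :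
    (starRingEnd ℂ l) ∈ spectrum ℂ a := by
  rw [spectrum.mem_iff] at h ⊢
  intro h2
  apply h
  have := conj_isUnit P h2
  rw [conj_sub, P.conj_algebraMap] at this
  simpa using this

theorem conj_spectralRadius (a : P.carrier) :
    spectralRadius ℂ (P.conj a) ≤ spectralRadius ℂ a := by
  unfold spectralRadius
  refine iSup₂_le fun k hk => ?_
  have h := conj_spectrum P hk
  refine le_trans ?_ (le_iSup₂ (f := fun (k : ℂ) (_ : k ∈ spectrum ℂ a) => (‖k‖₊ : ENNReal)) _ h)
  simp

theorem conj_norm_le (a : P.carrier) : ‖P.conj a‖ ≤ ‖a‖ := by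
  have h1 : IsSelfAdjoint (star a * a) := IsSelfAdjoint.star_mul_self a
  have h2 : IsSelfAdjoint (P.conj (star a * a)) := by
    rw [P.conj_mul, P.conj_star]; exact IsSelfAdjoint.star_mul_self _
  have h := conj_spectralRadius P (star a * a)
  rw [h1.spectralRadius_eq_nnnorm, h2.spectralRadius_eq_nnnorm] at h
  have h' : ‖P.conj (star a * a)‖ ≤ ‖star a * a‖ := by exact_mod_cast h
  rw [P.conj_mul, P.conj_star, CStarRing.norm_star_mul_self, CStarRing.norm_star_mul_self] at h'
  exact (mul_self_le_mul_self_iff (norm_nonneg _) (norm_nonneg _)).2 h'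

theorem conj_continuous : Continuous P.conj := by
  refine LipschitzWith.continuous (K := 1) (LipschitzWith.of_dist_le_mul fun a b => ?_)
  rw [dist_eq_norm, dist_eq_norm, ← conj_sub]
  simpa using conj_norm_le P (a - b)

theorem isClosed_fix : IsClosed {a : P.carrier | P.conj a = a} :=
  isClosed_eq (conj_continuous P) continuous_id

theorem isUnit_pair (a : P.carrier) : IsUnit (1 + star a * a) := by
  have h := spectrum_star_mul_self_nonneg (A := P.carrier) (b := a)
  by_contra hc
  have : (-1 : ℝ) ∈ spectrum ℝ (star a * a) := by
    rw [spectrum.mem_iff]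
    intro h3
    apply hc
    have := h3.neg
    simpa [add_comm] using this
  have := h _ this
  norm_num at this

theorem exists_inv (a : P.carrier) (ha : P.conj a = a) :
    ∃ b : P.carrier, P.conj b = b ∧
          b * (1 + star a * a) = 1 ∧ (1 + star a * a) * b = 1 := by
  obtain ⟨u, hu⟩ := isUnit_pair P a
  have hfix : P.conj (u : P.carrier) = u := by
    rw [hu, P.conj_add, P.conj_mul, P.conj_star, conj_one, ha]
  refine ⟨↑u⁻¹, ?_, ?_, ?_⟩
  · have h1 : P.conj (↑u⁻¹) * (u : P.carrier) = 1 := by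
      conv_lhs => rw [← hfix]
      rw [← P.conj_mul, Units.inv_mul, conj_one]
    exact left_inv_eq_right_inv h1 (Units.mul_inv u)
  · rw [← hu, Units.inv_mul]
  · rw [← hu, Units.mul_inv]

noncomputable def rp (a : P.carrier) : P.carrier := (1/2 : ℂ) • (a + P.conj a)
noncomputable def ip (a : P.carrier) : P.carrier := (-Complex.I/2 : ℂ) • (a - P.conj a)

theorem conj_rp (a : P.carrier) : P.conj (rp P a) = rp P a := by
  rw [rp, P.conj_smul, P.conj_add, P.conj_conj, add_comm]
  simp only [map_div₀, map_one]
  rw [show starRingEnd ℂ (2:ℂ) = 2 from map_ofNat _ 2]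

theorem conj_ip (a : P.carrier) : P.conj (ip P a) = ip P a := by
  rw [ip, P.conj_smul, conj_sub, P.conj_conj]
  simp only [map_div₀, map_neg, Complex.conj_I, neg_neg]
  rw [show starRingEnd ℂ (2:ℂ) = 2 from map_ofNat _ 2]
  module

theorem rp_ip (a : P.carrier) : rp P a + Complex.I • ip P a = a := by
  rw [rp, ip, smul_smul]
  have : Complex.I * (-Complex.I/2) = 1/2 := by
    have := Complex.I_mul_I
    linear_combination (-1/2) * this
  rw [this]
  module

theorem conj_comb {x y : P.carrier} (hx : P.conj x = x) (hy : P.conj y = y) :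
    P.conj (x + Complex.I • y) = x - Complex.I • y := by
  rw [P.conj_add, P.conj_smul, hx, hy]
  simp [sub_eq_add_neg]

theorem rp_comb {x y : P.carrier} (hx : P.conj x = x) (hy : P.conj y = y) :
    rp P (x + Complex.I • y) = x := by
  rw [rp, conj_comb P hx hy]
  module

theorem ip_comb {x y : P.carrier} (hx : P.conj x = x) (hy : P.conj y = y) :
    ip P (x + Complex.I • y) = y := by
  rw [ip, conj_comb P hx hy]
  have : x + Complex.I • y - (x - Complex.I • y) = (2 * Complex.I) • y := by module
  rw [this, smul_smul]
  have : (-Complex.I/2) * (2 * Complex.I) = 1 := by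
    have := Complex.I_mul_I
    linear_combination (-1) * this
  rw [this, one_smul]

theorem bij : Function.Bijective
        (fun q : {a : P.carrier // P.conj a = a} × {a : P.carrier // P.conj a = a} =>
          (q.1.1 + Complex.I • q.2.1 : P.carrier)) := by
  constructor
  · rintro ⟨⟨x, hx⟩, ⟨y, hy⟩⟩ ⟨⟨x', hx'⟩, ⟨y', hy'⟩⟩ h
    dsimp only at h
    have h1 : x = x' := by rw [← rp_comb P hx hy, h, rp_comb P hx' hy']
    have h2 : y = y' := by rw [← ip_comb P hx hy, h, ip_comb P hx' hy']
    subst h1 h2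
    rfl
  · intro a
    exact ⟨⟨⟨_, conj_rp P a⟩, ⟨_, conj_ip P a⟩⟩, rp_ip P a⟩

instance pairStarModule : StarModule ℝ P.carrier where
  star_smul r a := by
    rw [← Complex.coe_smul r a, star_smul, ← Complex.coe_smul]
    simp

theorem conj_real_smul (r : ℝ) (a : P.carrier) : P.conj (r • a) = r • P.conj a := by
  rw [← Complex.coe_smul r a, P.conj_smul, ← Complex.coe_smul]
  simp

def fixAlg : StarSubalgebra ℝ P.carrier where
  carrier := {a | P.conj a = a}
  mul_mem' {a b} ha hb := by
    simp only [Set.mem_ofPred_eq] at *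
    rw [P.conj_mul, ha, hb]
  add_mem' {a b} ha hb := by
    simp only [Set.mem_ofPred_eq] at *
    rw [P.conj_add, ha, hb]
  algebraMap_mem' r := by
    simp only [Set.mem_ofPred_eq]
    rw [Algebra.algebraMap_eq_smul_one, conj_real_smul, conj_one]
  star_mem' {a} ha := by
    simp only [Set.mem_ofPred_eq] at *
    change P.conj (star a) = star a
    rw [P.conj_star]
    exact congrArg star ha

theorem mem_fixAlg {a : P.carrier} : a ∈ fixAlg P ↔ P.conj a = a := Iff.rfl

noncomputable def fixObj : RealCStarAlg where
  carrier := fixAlg P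
  isCompleteSpace := (isClosed_fix P).completeSpace_coe
  isUnit_one_add_star_mul_self a := by
    obtain ⟨b, hb, h1, h2⟩ := exists_inv P a.1 a.2
    exact ⟨⟨1 + star a * a, ⟨b, hb⟩, Subtype.ext h2, Subtype.ext h1⟩, rfl⟩

end pair
end RC

namespace RC

section functor

def fixMapFun {P Q : CStarConjPair} (f : P ⟶ Q) : fixAlg P →⋆ₐ[ℝ] fixAlg Q where
  toFun a := ⟨f.1 a.1, by
    rw [mem_fixAlg, ← f.2.2]; exact congrArg f.1 a.2⟩
  map_one' := Subtype.ext (map_one f.1)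
  map_mul' a b := Subtype.ext (map_mul f.1 a.1 b.1)
  map_zero' := Subtype.ext (map_zero f.1)
  map_add' a b := Subtype.ext (map_add f.1 a.1 b.1)
  commutes' r := Subtype.ext (f.1.commutes' (r : ℂ))
  map_star' a := Subtype.ext (map_star f.1 a.1)

theorem fixMapFun_coe {P Q : CStarConjPair} (f : P ⟶ Q) (a : fixAlg P) :
    (fixMapFun f a : Q.carrier) = f.1 a.1 := rfl

noncomputable def fixFunctor : CStarConjPair ⥤ RealCStarAlg where
  obj P := fixObj P
  map {P Q} f := ⟨fixMapFun f,
    Continuous.subtype_mk (f.2.1.comp continuous_subtype_val) _⟩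
  map_id _ := Subtype.ext (StarAlgHom.ext fun _ => rfl)
  map_comp _ _ := Subtype.ext (StarAlgHom.ext fun _ => rfl)

theorem faithful : fixFunctor.Faithful where
  map_injective {P Q f g} h := by
    have h1 : ∀ x : fixAlg P, f.1 x.1 = g.1 x.1 := fun x => by
      have h2 : fixMapFun f = fixMapFun g := congrArg Subtype.val h
      rw [← fixMapFun_coe, ← fixMapFun_coe, h2]
    refine Subtype.ext (StarAlgHom.ext fun a => ?_)
    rw [← rp_ip P a, map_add, map_add, map_smul, map_smul]
    have e1 := h1 ⟨_, conj_rp P a⟩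
    have e2 := h1 ⟨_, conj_ip P a⟩
    dsimp only at e1 e2
    rw [e1, e2]

noncomputable def RX (P : CStarConjPair) (a : P.carrier) : fixAlg P := ⟨rp P a, conj_rp P a⟩
noncomputable def IX (P : CStarConjPair) (a : P.carrier) : fixAlg P := ⟨ip P a, conj_ip P a⟩

theorem RX_IX (P : CStarConjPair) (a : P.carrier) :
    (RX P a : P.carrier) + Complex.I • (IX P a : P.carrier) = a := rp_ip P a

noncomputable def extFun {P Q : CStarConjPair} (g : fixAlg P →⋆ₐ[ℝ] fixAlg Q) (a : P.carrier) :
    Q.carrier := (g (RX P a) : Q.carrier) + Complex.I • (g (IX P a) : Q.carrier)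

theorem extFun_eq {P Q : CStarConjPair} (g : fixAlg P →⋆ₐ[ℝ] fixAlg Q) (a : P.carrier)
    (x y : fixAlg P) (h : a = (x : P.carrier) + Complex.I • (y : P.carrier)) :
    extFun g a = (g x : Q.carrier) + Complex.I • (g y : Q.carrier) := by
  have h1 : RX P a = x := Subtype.ext (by rw [h]; exact rp_comb P x.2 y.2)
  have h2 : IX P a = y := Subtype.ext (by rw [h]; exact ip_comb P x.2 y.2)
  rw [extFun, h1, h2]

theorem mul_comb {A : Type*} [Ring A] [Algebra ℂ A] (x y u v : A) :
    (x + Complex.I • y) * (u + Complex.I • v)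
      = (x * u - y * v) + Complex.I • (x * v + y * u) := by
  simp only [mul_add, add_mul, smul_mul_assoc, mul_smul_comm]
  have h : Complex.I • Complex.I • (y * v) = -(y * v) := by
    rw [smul_smul, Complex.I_mul_I, neg_one_smul]
  simp only [smul_add, h]
  module

theorem smul_comb {A : Type*} [AddCommGroup A] [Module ℂ A] (c : ℂ) (x y : A) :
    c • (x + Complex.I • y)
      = (c.re • x - c.im • y) + Complex.I • (c.re • y + c.im • x) := by
  have h : c = c.re + c.im * Complex.I := (Complex.re_add_im c).symm
  rw [← Complex.coe_smul, ← Complex.coe_smul, ← Complex.coe_smul, ← Complex.coe_smul]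
  conv_lhs => rw [h]
  have h2 : Complex.I • Complex.I • y = -y := by
    rw [smul_smul, Complex.I_mul_I, neg_one_smul]
  have h3 : (((c.re : ℂ) + c.im * Complex.I) • (x + Complex.I • y) : A)
      = (c.re : ℂ) • x + (c.re : ℂ) • Complex.I • y + (c.im : ℂ) • Complex.I • x
        + (c.im : ℂ) • (Complex.I • Complex.I • y) := by module
  rw [h3, h2]
  module

theorem star_comb (P : CStarConjPair) (x y : P.carrier) :
    star (x + Complex.I • y) = star x + Complex.I • (- star y) := by
  rw [star_add, star_smul]
  simp

theorem extFun_coe {P Q : CStarConjPair} (g : fixAlg P →⋆ₐ[ℝ] fixAlg Q) (x : fixAlg P) :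
    extFun g x = g x := by
  rw [extFun_eq g _ x 0 (by simp)]
  simp

theorem extFun_smul {P Q : CStarConjPair} (g : fixAlg P →⋆ₐ[ℝ] fixAlg Q) (c : ℂ)
    (a : P.carrier) : extFun g (c • a) = c • extFun g a := by
  rw [extFun_eq g (c • a) (c.re • RX P a - c.im • IX P a) (c.re • IX P a + c.im • RX P a)]
  · rw [map_sub, map_add, map_smul, map_smul, map_smul, map_smul, extFun, smul_comb]
    rfl
  · conv_lhs => rw [← RX_IX P a, smul_comb]
    rfl

noncomputable def extHom {P Q : CStarConjPair} (g : fixAlg P →⋆ₐ[ℝ] fixAlg Q) :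
    P.carrier →⋆ₐ[ℂ] Q.carrier where
  toFun := extFun g
  map_one' := by
    have := extFun_coe g 1
    simpa using this
  map_zero' := by
    have := extFun_coe g 0
    simpa using this
  map_mul' a b := by
    rw [extFun_eq g (a * b) (RX P a * RX P b - IX P a * IX P b)
      (RX P a * IX P b + IX P a * RX P b)]
    · rw [map_sub, map_add, map_mul, map_mul, map_mul, map_mul, extFun, extFun, mul_comb]
      rfl
    · conv_lhs => rw [← RX_IX P a, ← RX_IX P b, mul_comb]
      rfl
  map_add' a b := by
    rw [extFun_eq g (a + b) (RX P a + RX P b) (IX P a + IX P b)]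
    · rw [map_add, map_add, extFun, extFun, AddMemClass.coe_add, AddMemClass.coe_add]
      module
    · conv_lhs => rw [← RX_IX P a, ← RX_IX P b]
      rw [AddMemClass.coe_add, AddMemClass.coe_add]
      module
  commutes' c := by
    have := extFun_smul g c 1
    have h1 : extFun g 1 = 1 := by
      have := extFun_coe g 1
      simpa using this
    rw [Algebra.algebraMap_eq_smul_one, Algebra.algebraMap_eq_smul_one, ← h1, ← this]
  map_star' a := by
    change extFun g (star a) = star (extFun g a)
    rw [extFun_eq g (star a) (star (RX P a)) (- star (IX P a))]
    · rw [map_neg, map_star, map_star, extFun, star_comb]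
      rfl
    · conv_lhs => rw [← RX_IX P a, star_comb]
      rfl

theorem extFun_conj {P Q : CStarConjPair} (g : fixAlg P →⋆ₐ[ℝ] fixAlg Q) (a : P.carrier) :
    extFun g (P.conj a) = Q.conj (extFun g a) := by
  rw [extFun_eq g (P.conj a) (RX P a) (- IX P a)]
  · rw [extFun, conj_comb Q (g (RX P a)).2 (g (IX P a)).2, map_neg, NegMemClass.coe_neg]
    module
  · conv_lhs => rw [← RX_IX P a]
    rw [conj_comb P (RX P a).2 (IX P a).2, NegMemClass.coe_neg]
    module

theorem extFun_continuous {P Q : CStarConjPair} (g : fixAlg P →⋆ₐ[ℝ] fixAlg Q)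
    (hg : Continuous g) : Continuous (extFun g) := by
  have h1 : Continuous (RX P) := Continuous.subtype_mk
    ((continuous_id.add (conj_continuous P)).const_smul _) _
  have h2 : Continuous (IX P) := Continuous.subtype_mk
    ((continuous_id.sub (conj_continuous P)).const_smul _) _
  exact (continuous_subtype_val.comp (hg.comp h1)).add
    ((continuous_subtype_val.comp (hg.comp h2)).const_smul _)

theorem full : fixFunctor.Full where
  map_surjective {P Q} g := by
    refine ⟨⟨extHom g.1, extFun_continuous g.1 g.2, extFun_conj g.1⟩, ?_⟩
    refine Subtype.ext (StarAlgHom.ext fun x => Subtype.ext ?_)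
    exact extFun_coe (P := P) (Q := Q) g.1 x

theorem fix_im (B : RealCStarAlg) (z : fixAlg (toPair B)) : (z.1 : Cx B).im = 0 := by
  have h : (⟨(z.1 : Cx B).re, -(z.1 : Cx B).im⟩ : Cx B) = z.1 := z.2
  have h2 : -(z.1 : Cx B).im = (z.1 : Cx B).im := congrArg Cx.im h
  have h3 : (2 : ℝ) • (z.1 : Cx B).im = 0 := by
    rw [two_smul]; nth_rewrite 1 [← h2]; simp
  exact (smul_eq_zero.1 h3).resolve_left (by norm_num)

def fwdFun (B : RealCStarAlg) (x : B.carrier) : fixAlg (toPair B) :=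
  ⟨(⟨x, 0⟩ : Cx B), by
    change (⟨x, -0⟩ : Cx B) = ⟨x, 0⟩
    rw [neg_zero]⟩

def fwd (B : RealCStarAlg) : B.carrier →⋆ₐ[ℝ] fixAlg (toPair B) where
  toFun := fwdFun B
  map_one' := rfl
  map_zero' := rfl
  map_mul' x y := Subtype.ext (by
    change (⟨x * y, 0⟩ : Cx B) = ⟨x, 0⟩ * ⟨y, 0⟩
    ext <;> simp)
  map_add' x y := Subtype.ext (by
    change (⟨x + y, 0⟩ : Cx B) = ⟨x, 0⟩ + ⟨y, 0⟩
    ext <;> simp)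
  commutes' r := Subtype.ext (by
    change (⟨algebraMap ℝ B.carrier r, 0⟩ : Cx B) = algebraMap ℂ (Cx B) (r : ℂ)
    rw [Algebra.algebraMap_eq_smul_one, Algebra.algebraMap_eq_smul_one]
    ext
    · rw [Cx.smul_re]; simp
    · rw [Cx.smul_im]; simp)
  map_star' x := Subtype.ext (by
    change (⟨star x, 0⟩ : Cx B) = star (⟨x, 0⟩ : Cx B)
    ext <;> simp)

def bwd (B : RealCStarAlg) : fixAlg (toPair B) →⋆ₐ[ℝ] B.carrier where
  toFun z := (z.1 : Cx B).re
  map_one' := rfl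
  map_zero' := rfl
  map_mul' x y := by
    have hx := fix_im B x
    refine (Cx.mul_re (x.1 : Cx B) (y.1 : Cx B)).trans ?_
    rw [hx, zero_mul, sub_zero]
  map_add' x y := rfl
  commutes' r := by
    change (algebraMap ℂ (Cx B) (r : ℂ)).re = algebraMap ℝ B.carrier r
    rw [Algebra.algebraMap_eq_smul_one, Algebra.algebraMap_eq_smul_one]
    rw [Cx.smul_re]; simp
  map_star' x := rfl

theorem fwd_continuous (B : RealCStarAlg) : Continuous (fwd B) := by
  refine Continuous.subtype_mk (?_ : Continuous (fun x : B.carrier => (⟨x, 0⟩ : Cx B))) _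
  refine LipschitzWith.continuous (K := 1) (LipschitzWith.of_dist_le_mul fun a b => ?_)
  rw [dist_eq_norm, dist_eq_norm]
  have h := norm_le ((⟨a, 0⟩ : Cx B) - ⟨b, 0⟩)
  simpa using h

theorem re_continuous (B : RealCStarAlg) : Continuous (fun z : Cx B => z.re) := by
  refine LipschitzWith.continuous (K := 1) (LipschitzWith.of_dist_le_mul fun a b => ?_)
  rw [dist_eq_norm, dist_eq_norm]
  have h := norm_re_le (a - b)
  simpa using h

theorem bwd_continuous (B : RealCStarAlg) : Continuous (bwd B) :=
  (re_continuous B).comp continuous_subtype_val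

theorem essSurj : fixFunctor.EssSurj where
  mem_essImage B := by
    refine ⟨toPair B, ⟨⟨⟨bwd B, bwd_continuous B⟩, ⟨fwd B, fwd_continuous B⟩, ?_, ?_⟩⟩⟩
    · refine Subtype.ext (StarAlgHom.ext fun z => Subtype.ext ?_)
      change (⟨(z.1 : Cx B).re, 0⟩ : Cx B) = z.1
      exact Cx.ext rfl (fix_im B z).symm
    · exact Subtype.ext (StarAlgHom.ext fun _ => rfl)

theorem isEquiv : fixFunctor.IsEquivalence :=
  { faithful := faithful, full := full, essSurj := essSurj }

end functor

end RC


/-- The category of unital real C*-algebras is equivalent to the category of pairs `(A, τ)`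
of a unital complex C*-algebra with a conjugate-linear multiplicative involution `τ`
commuting with `*` and conjugating scalars (one direction of the equivalence sends `B`
to its complexification `B ⊗_ℝ ℂ` with complex conjugation, the quasi-inverse sends
`(A, τ)` to the fixed-point algebra `A^τ`).  In particular, for every pair `(A, τ)`:
the fixed-point set `A^τ` is topologically closed (hence a unital real C*-algebra with
the induced structure — it is evidently a real *-subalgebra); `1 + a*a` is invertible
within `A^τ` for every `a ∈ A^τ`; and `A = A^τ ⊕ i·A^τ`, i.e. the canonical map
`A^τ ⊗_ℝ ℂ → A`, `(x, y) ↦ x + i·y`, is bijective. -/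
theorem realCStarAlg_equiv_conjPairs :
    Nonempty (CStarConjPair ≌ RealCStarAlg) ∧
    ∀ P : CStarConjPair,
      IsClosed {a : P.carrier | P.conj a = a} ∧
      (∀ a : P.carrier, P.conj a = a →
        ∃ b : P.carrier, P.conj b = b ∧
          b * (1 + star a * a) = 1 ∧ (1 + star a * a) * b = 1) ∧
      Function.Bijective
        (fun q : {a : P.carrier // P.conj a = a} × {a : P.carrier // P.conj a = a} =>
          (q.1.1 + Complex.I • q.2.1 : P.carrier)) := by

  have := RC.isEquiv
  exact ⟨⟨RC.fixFunctor.asEquivalence⟩,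
    fun P => ⟨RC.isClosed_fix P, RC.exists_inv P, RC.bij P⟩⟩
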